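/- Assume (H1)-(H2), and let x_⋆ ∈ ℝⁿ satisfy x_⋆ ≤ g for all g ∈ Γ. Let B be an unordered connected component of 𝓑(Φ) and let x ∈ B. Then one of the following holds: (i) there exist a sequence z_n → x with x ≪ z_n for all n, and equilibria q_n ∈ α(z_n) ∩ E with x ≤ q_n for all n; or (ii) there exists a sequence z_n ∈ R₋(+∞) with z_n → x and x ≪ z_n for all n. -/

import Mathlib

open Set Metric Filter Topology Pointwise

noncomputable section

abbrev Euc (n : ℕ) := EuclideanSpace ℝ (Fin n)

/-- `Φ` is a continuous flow on `ℝⁿ`. -/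
def IsFlow {n : ℕ} (Φ : ℝ → Euc n → Euc n) : Prop :=
  Continuous (fun p : ℝ × Euc n => Φ p.1 p.2) ∧
  (∀ x, Φ 0 x = x) ∧
  (∀ t s x, Φ t (Φ s x) = Φ (t + s) x)

/-- `Cp` is a closed, solid, salient convex cone. -/
def IsConeOrder {n : ℕ} (Cp : Set (Euc n)) : Prop :=
  IsClosed Cp ∧ (∀ x ∈ Cp, ∀ y ∈ Cp, x + y ∈ Cp) ∧
  (∀ α : ℝ, 0 < α → ∀ x ∈ Cp, α • x ∈ Cp) ∧
  (interior Cp).Nonempty ∧ Cp ∩ (-Cp) = {0}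

/-- `x ≤ y` iff `y - x ∈ C⁺`. -/
def coneLe {n : ℕ} (Cp : Set (Euc n)) (x y : Euc n) : Prop := y - x ∈ Cp

/-- `x < y` iff `y - x ∈ C⁺ \ {0}`. -/
def coneLt {n : ℕ} (Cp : Set (Euc n)) (x y : Euc n) : Prop := y - x ∈ Cp ∧ y ≠ x

/-- `x ≪ y` iff `y - x ∈ Int C⁺`. -/
def coneLL {n : ℕ} (Cp : Set (Euc n)) (x y : Euc n) : Prop := y - x ∈ interior Cp

/-- `S` is unordered: no two distinct points related by `≤`. -/
def Unordered {n : ℕ} (Cp : Set (Euc n)) (S : Set (Euc n)) : Prop :=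
  ∀ x ∈ S, ∀ y ∈ S, x ≠ y → ¬ coneLe Cp x y

/-- (H1): `Φ` is strongly competitive. -/
def StronglyCompetitive {n : ℕ} (Φ : ℝ → Euc n → Euc n) (Cp : Set (Euc n)) : Prop :=
  ∀ t : ℝ, 0 < t → ∀ x y : Euc n,
    (coneLe Cp (Φ t x) (Φ t y) → coneLe Cp x y) ∧
    (coneLt Cp (Φ t x) (Φ t y) → coneLL Cp x y)

/-- `D` is invariant under the flow. -/
def Invariant {n : ℕ} (Φ : ℝ → Euc n → Euc n) (D : Set (Euc n)) : Prop :=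
  ∀ t : ℝ, Φ t '' D = D

/-- (H2): `Γ` is a compact invariant attractor uniformly attracting all compact sets. -/
def Dissipative {n : ℕ} (Φ : ℝ → Euc n → Euc n) (Γ : Set (Euc n)) : Prop :=
  Γ.Nonempty ∧ IsCompact Γ ∧ Invariant Φ Γ ∧
  ∀ N : Set (Euc n), IsCompact N → ∀ ε > 0, ∃ T : ℝ, ∀ t ≥ T, ∀ x ∈ N,
    Metric.infDist (Φ t x) Γ < ε

/-- The ω-limit set of `x`. -/
def omegaSet {n : ℕ} (Φ : ℝ → Euc n → Euc n) (x : Euc n) : Set (Euc n) :=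
  ⋂ t ∈ Ici (0 : ℝ), closure ((fun τ => Φ τ x) '' Ici t)

/-- The α-limit set of `x`. -/
def alphaSet {n : ℕ} (Φ : ℝ → Euc n → Euc n) (x : Euc n) : Set (Euc n) :=
  ⋂ t ∈ Iic (0 : ℝ), closure ((fun τ => Φ τ x) '' Iic t)

/-- The set `R(Φ)` of recurrent points. -/
def recurrentSet {n : ℕ} (Φ : ℝ → Euc n → Euc n) : Set (Euc n) :=
  {x | x ∈ omegaSet Φ x}

/-- The Birkhoff center `𝓑(Φ)`. -/
def birkhoffCenter {n : ℕ} (Φ : ℝ → Euc n → Euc n) : Set (Euc n) :=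
  closure (recurrentSet Φ)

/-- The set `E` of equilibria. -/
def equilibria {n : ℕ} (Φ : ℝ → Euc n → Euc n) : Set (Euc n) :=
  {p | ∀ t : ℝ, Φ t p = p}

/-- `C = C⁺ ∪ (−C⁺)`. -/
def coneC {n : ℕ} (Cp : Set (Euc n)) : Set (Euc n) := Cp ∪ (-Cp)

/-- `K = closure(ℝⁿ \ C)`. -/
def coneK {n : ℕ} (Cp : Set (Euc n)) : Set (Euc n) := closure ((coneC Cp)ᶜ)

/-- The translated cone `C_x = x + C`. -/
def coneCAt {n : ℕ} (Cp : Set (Euc n)) (x : Euc n) : Set (Euc n) := {y | y - x ∈ coneC Cp}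

/-- The translated complementary cone `K_x = x + K`. -/
def coneKAt {n : ℕ} (Cp : Set (Euc n)) (x : Euc n) : Set (Euc n) := {y | y - x ∈ coneK Cp}


/-- The lower boundary `∂₋S`. -/
def lowerBdry {n : ℕ} (Cp : Set (Euc n)) (S : Set (Euc n)) : Set (Euc n) :=
  {z | (∃ u : ℕ → Euc n, (∀ i, u i ∈ S) ∧ Filter.Tendsto u Filter.atTop (nhds z) ∧
          ∀ i, coneLL Cp z (u i)) ∧
       ¬ ∃ v : ℕ → Euc n, (∀ i, v i ∈ S) ∧ Filter.Tendsto v Filter.atTop (nhds z) ∧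
          ∀ i, coneLL Cp (v i) z}

/-- The upper boundary `∂₊S`. -/
def upperBdry {n : ℕ} (Cp : Set (Euc n)) (S : Set (Euc n)) : Set (Euc n) :=
  {z | (∃ v : ℕ → Euc n, (∀ i, v i ∈ S) ∧ Filter.Tendsto v Filter.atTop (nhds z) ∧
          ∀ i, coneLL Cp (v i) z) ∧
       ¬ ∃ u : ℕ → Euc n, (∀ i, u i ∈ S) ∧ Filter.Tendsto u Filter.atTop (nhds z) ∧
          ∀ i, coneLL Cp z (u i)}

/-- The basin of repulsion `R(q)`. -/
def basinRep {n : ℕ} (Φ : ℝ → Euc n → Euc n) (q : Euc n) : Set (Euc n) :=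
  {x | Filter.Tendsto (fun t : ℝ => Φ (-t) x) Filter.atTop (nhds q)}

/-- The basin of lower repulsion `R₋(q)`. -/
def basinRepLower {n : ℕ} (Φ : ℝ → Euc n → Euc n) (Cp : Set (Euc n)) (q : Euc n) :
    Set (Euc n) :=
  {x ∈ basinRep Φ q | ∃ T : ℝ, 0 < T ∧ ∀ t ≥ T, coneLL Cp (Φ (-t) x) q}

/-- The basin of upper repulsion `R₊(q)`. -/
def basinRepUpper {n : ℕ} (Φ : ℝ → Euc n → Euc n) (Cp : Set (Euc n)) (q : Euc n) :
    Set (Euc n) :=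
  {x ∈ basinRep Φ q | ∃ T : ℝ, 0 < T ∧ ∀ t ≥ T, coneLL Cp q (Φ (-t) x)}

/-- `M₋(q) = ∂₋R₋(q)`. -/
def Mminus {n : ℕ} (Φ : ℝ → Euc n → Euc n) (Cp : Set (Euc n)) (q : Euc n) : Set (Euc n) :=
  lowerBdry Cp (basinRepLower Φ Cp q)

/-- `M₊(p) = ∂₊R₊(p)`. -/
def Mplus {n : ℕ} (Φ : ℝ → Euc n → Euc n) (Cp : Set (Euc n)) (p : Euc n) : Set (Euc n) :=
  upperBdry Cp (basinRepUpper Φ Cp p)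

/-- `R(∞) = {x : |Φ_{−t}(x)| → ∞}`. -/
def repInfty {n : ℕ} (Φ : ℝ → Euc n → Euc n) : Set (Euc n) :=
  {x | Filter.Tendsto (fun t : ℝ => ‖Φ (-t) x‖) Filter.atTop Filter.atTop}

/-- `R₋(+∞) = Int R̃₋(+∞)`. -/
def RminusInfty {n : ℕ} (Φ : ℝ → Euc n → Euc n) (Cp : Set (Euc n)) (xlo : Euc n) :
    Set (Euc n) :=
  interior {x ∈ repInfty Φ | ∃ T : ℝ, 0 < T ∧ ∀ t ≥ T, coneLL Cp xlo (Φ (-t) x)}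

/-- `M₋(+∞) = ∂₋R₋(+∞)`. -/
def MminusInfty {n : ℕ} (Φ : ℝ → Euc n → Euc n) (Cp : Set (Euc n)) (xlo : Euc n) :
    Set (Euc n) :=
  lowerBdry Cp (RminusInfty Φ Cp xlo)

/-- `R₊(−∞) = Int R̃₊(−∞)`. -/
def RplusInfty {n : ℕ} (Φ : ℝ → Euc n → Euc n) (Cp : Set (Euc n)) (xhi : Euc n) :
    Set (Euc n) :=
  interior {x ∈ repInfty Φ | ∃ T : ℝ, 0 < T ∧ ∀ t ≥ T, coneLL Cp (Φ (-t) x) xhi}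

/-- `M₊(−∞) = ∂₊R₊(−∞)`. -/
def MplusInfty {n : ℕ} (Φ : ℝ → Euc n → Euc n) (Cp : Set (Euc n)) (xhi : Euc n) :
    Set (Euc n) :=
  upperBdry Cp (RplusInfty Φ Cp xhi)

section ConeOrder

variable {n : ℕ} {Cp : Set (Euc n)}

lemma coneLe_refl (hC : IsConeOrder Cp) (x : Euc n) : coneLe Cp x x := by
  have h : (0 : Euc n) ∈ Cp ∩ -Cp := by rw [hC.2.2.2.2]; rfl
  simpa [coneLe] using h.1

lemma coneLe_trans (hC : IsConeOrder Cp) {x y z : Euc n} (hxy : coneLe Cp x y)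
    (hyz : coneLe Cp y z) : coneLe Cp x z := by
  have h := hC.2.1 _ hyz _ hxy
  simpa [coneLe] using h

lemma coneLe_antisymm (hC : IsConeOrder Cp) {x y : Euc n} (hxy : coneLe Cp x y)
    (hyx : coneLe Cp y x) : x = y := by
  have h : y - x ∈ Cp ∩ -Cp := ⟨hxy, by simpa [coneLe] using hyx⟩
  rw [hC.2.2.2.2] at h
  exact (sub_eq_zero.mp h).symm

lemma coneLL.le {x y : Euc n} (h : coneLL Cp x y) : coneLe Cp x y := interior_subset h

lemma add_mem_interior_cone (hC : IsConeOrder Cp) {v w : Euc n} (hv : v ∈ Cp)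
    (hw : w ∈ interior Cp) : v + w ∈ interior Cp := by
  have hsub : Cp + Cp ⊆ Cp := by
    rintro _ ⟨a, ha, b, hb, rfl⟩
    exact hC.2.1 a ha b hb
  exact interior_mono hsub (subset_interior_add_right (Set.add_mem_add hv hw))

lemma coneLe_trans_coneLL (hC : IsConeOrder Cp) {x y z : Euc n} (hxy : coneLe Cp x y)
    (hyz : coneLL Cp y z) : coneLL Cp x z := by
  have h := add_mem_interior_cone hC hxy hyz
  have e : y - x + (z - y) = z - x := by abel
  rwa [e] at h

lemma coneLL_trans_coneLe (hC : IsConeOrder Cp) {x y z : Euc n} (hxy : coneLL Cp x y)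
    (hyz : coneLe Cp y z) : coneLL Cp x z := by
  have h := add_mem_interior_cone hC hyz hxy
  have e : z - y + (y - x) = z - x := by abel
  rwa [e] at h

lemma smul_mem_interior_cone (hC : IsConeOrder Cp) {v : Euc n} (hv : v ∈ interior Cp)
    {a : ℝ} (ha : 0 < a) : a • v ∈ interior Cp := by
  have hsub : a • Cp ⊆ Cp := by
    rintro _ ⟨w, hw, rfl⟩
    exact hC.2.2.1 a ha w hw
  refine interior_mono hsub ?_
  rw [interior_smul₀ ha.ne']
  exact Set.smul_mem_smul_set hv

lemma coneLL_add_smul (hC : IsConeOrder Cp) {v : Euc n} (hv : v ∈ interior Cp) (x : Euc n)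
    {a b : ℝ} (hab : a < b) : coneLL Cp (x + a • v) (x + b • v) := by
  have h := smul_mem_interior_cone hC hv (sub_pos.mpr hab)
  have e : (b - a) • v = x + b • v - (x + a • v) := by rw [sub_smul]; abel
  rwa [e] at h

lemma isClosed_coneLe (hC : IsConeOrder Cp) :
    IsClosed {p : Euc n × Euc n | coneLe Cp p.1 p.2} :=
  hC.1.preimage (continuous_snd.sub continuous_fst)

lemma isOpen_coneLL : IsOpen {p : Euc n × Euc n | coneLL Cp p.1 p.2} :=
  isOpen_interior.preimage (continuous_snd.sub continuous_fst)

lemma coneLe_of_frequently {ι : Type*} (hC : IsConeOrder Cp) {l : Filter ι}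
    {f g : ι → Euc n} {a b : Euc n} (hf : Tendsto f l (𝓝 a)) (hg : Tendsto g l (𝓝 b))
    (h : ∃ᶠ i in l, coneLe Cp (f i) (g i)) : coneLe Cp a b :=
  (isClosed_coneLe hC).mem_of_frequently_of_tendsto h (hf.prodMk_nhds hg)

lemma eventually_coneLL {ι : Type*} {l : Filter ι}
    {f g : ι → Euc n} {a b : Euc n} (hf : Tendsto f l (𝓝 a)) (hg : Tendsto g l (𝓝 b))
    (h : coneLL Cp a b) : ∀ᶠ i in l, coneLL Cp (f i) (g i) :=
  (hf.prodMk_nhds hg).eventually (isOpen_coneLL.mem_nhds h)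

lemma subsingleton_of_zero_mem_interior_cone (hC : IsConeOrder Cp)
    (h : (0 : Euc n) ∈ interior Cp) : Subsingleton (Euc n) := by
  refine subsingleton_of_forall_eq 0 fun v => ?_
  have h1 : Tendsto (fun a : ℝ => a • v) (𝓝[>] 0) (𝓝 0) := by
    have : Tendsto (fun a : ℝ => a • v) (𝓝 0) (𝓝 ((0 : ℝ) • v)) :=
      (continuous_id.smul continuous_const).tendsto 0
    rw [zero_smul] at this
    exact this.mono_left nhdsWithin_le_nhds
  have h2 : Tendsto (fun a : ℝ => -(a • v)) (𝓝[>] 0) (𝓝 0) := by simpa using h1.neg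
  have hn : Cp ∈ 𝓝 (0 : Euc n) := mem_interior_iff_mem_nhds.mp h
  obtain ⟨a, ⟨ha1, ha2⟩, ha⟩ :=
    (((h1.eventually hn).and (h2.eventually hn)).and self_mem_nhdsWithin).exists
  have h3 : a • v ∈ Cp ∩ -Cp := ⟨ha1, ha2⟩
  rw [hC.2.2.2.2] at h3
  exact (smul_eq_zero.mp h3).resolve_left (ne_of_gt ha)

end ConeOrder

/-- `Ψ` is strongly monotone for the order given by `Cp`. -/
def StronglyMonotone {n : ℕ} (Ψ : ℝ → Euc n → Euc n) (Cp : Set (Euc n)) : Prop :=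
  ∀ t : ℝ, 0 < t → ∀ x y : Euc n, coneLt Cp x y → coneLL Cp (Ψ t x) (Ψ t y)

section MonotoneFlow

variable {n : ℕ} {Ψ : ℝ → Euc n → Euc n} {Cp : Set (Euc n)}

lemma IsFlow.continuous_point (hΨ : IsFlow Ψ) (t : ℝ) : Continuous (Ψ t) :=
  hΨ.1.comp (Continuous.prodMk_right t)

lemma IsFlow.continuous_time (hΨ : IsFlow Ψ) (x : Euc n) : Continuous fun t => Ψ t x :=
  hΨ.1.comp (Continuous.prodMk_left x)

lemma StronglyMonotone.map_le (hΨ : IsFlow Ψ) (hC : IsConeOrder Cp)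
    (hm : StronglyMonotone Ψ Cp) {t : ℝ} (ht : 0 ≤ t) {x y : Euc n} (h : coneLe Cp x y) :
    coneLe Cp (Ψ t x) (Ψ t y) := by
  rcases ht.eq_or_lt with rfl | ht
  · rwa [hΨ.2.1, hΨ.2.1]
  · by_cases e : y = x
    · rw [e]; exact coneLe_refl hC _
    · exact (hm t ht x y ⟨h, e⟩).le

lemma IsFlow.mem_equilibria_of_eventually (hΨ : IsFlow Ψ) {p : Euc n}
    (h : ∀ᶠ t in 𝓝 (0 : ℝ), Ψ t p = p) : p ∈ equilibria Ψ := by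
  intro t
  have hlim : Tendsto (fun k : ℕ => t / k) atTop (𝓝 0) :=
    tendsto_const_div_atTop_nhds_zero_nat t
  obtain ⟨k, hk, hk0⟩ := ((hlim.eventually h).and (eventually_gt_atTop 0)).exists
  have hit : ∀ m : ℕ, Ψ (m * (t / k)) p = p := by
    intro m
    induction m with
    | zero => simpa using hΨ.2.1 p
    | succ m ih =>
      have e : ((m + 1 : ℕ) : ℝ) * (t / k) = t / k + m * (t / k) := by push_cast; ring
      rw [e, ← hΨ.2.2, ih, hk]
  have e : (k : ℝ) * (t / k) = t := by
    have : (k : ℝ) ≠ 0 := by exact_mod_cast hk0.ne'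
    field_simp
  rw [← e]
  exact hit k

lemma IsFlow.mapClusterPt_apply (hΨ : IsFlow Ψ) {z p : Euc n}
    (hp : MapClusterPt p atTop fun t => Ψ t z) (h : ℝ) :
    MapClusterPt (Ψ h p) atTop fun t => Ψ t z := by
  have h1 : MapClusterPt (Ψ h p) atTop (Ψ h ∘ fun t => Ψ t z) :=
    hp.tendsto_comp ((hΨ.continuous_point h).tendsto p)
  have e : (Ψ h ∘ fun t => Ψ t z) = (fun t => Ψ t z) ∘ fun t => h + t := by
    funext t; exact hΨ.2.2 h t z
  rw [e] at h1
  exact h1.of_comp (tendsto_atTop_add_const_left _ h tendsto_id)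

/-- If a point moves up strongly in some positive time, then it lies below all of its
sufficiently late states. -/
lemma exists_forall_ge_coneLe (hΨ : IsFlow Ψ) (hC : IsConeOrder Cp)
    (hm : StronglyMonotone Ψ Cp) {w : Euc n} {T : ℝ} (hT : 0 < T)
    (hw : coneLL Cp w (Ψ T w)) : ∃ T₀ : ℝ, ∀ t ≥ T₀, coneLe Cp w (Ψ t w) := by
  have hev : ∀ᶠ s in 𝓝 T, coneLL Cp w (Ψ s w) :=
    eventually_coneLL tendsto_const_nhds ((hΨ.continuous_time w).tendsto T) hw
  obtain ⟨δ, hδ, hball⟩ := Metric.eventually_nhds_iff.mp hev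
  have hit : ∀ s : ℝ, 0 ≤ s → coneLe Cp w (Ψ s w) → ∀ k : ℕ, coneLe Cp w (Ψ (k * s) w) := by
    intro s hs hws k
    induction k with
    | zero => simpa [hΨ.2.1] using coneLe_refl hC w
    | succ k ih =>
      have e : ((k + 1 : ℕ) : ℝ) * s = s + k * s := by push_cast; ring
      rw [e, ← hΨ.2.2]
      exact coneLe_trans hC hws (hm.map_le hΨ hC hs ih)
  refine ⟨T ^ 2 / δ + T, fun t ht => ?_⟩
  have ht0 : 0 < t := lt_of_lt_of_le (by positivity) ht
  set k : ℕ := ⌈t / T⌉₊ with hk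
  have hk1 : t / T ≤ k := Nat.le_ceil _
  have hk2 : (k : ℝ) < t / T + 1 := Nat.ceil_lt_add_one (by positivity)
  have hk0 : (0 : ℝ) < k := lt_of_lt_of_le (by positivity) hk1
  have h1 : t / k ≤ T := by
    rw [div_le_iff₀ hk0]
    rw [div_le_iff₀ hT] at hk1
    linarith
  have h2 : T - t / k < δ := by
    have hTδ : T ^ 2 / δ < t := by linarith
    rw [div_lt_iff₀ hδ] at hTδ
    have hkT : k * T < t + T := by
      have := mul_lt_mul_of_pos_right hk2 hT
      rwa [add_mul, div_mul_cancel₀ _ hT.ne', one_mul] at this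
    have hkd : T < k * δ := by
      have : t ≤ k * T := by rwa [div_le_iff₀ hT] at hk1
      nlinarith
    rw [sub_lt_iff_lt_add, ← sub_lt_iff_lt_add', lt_div_iff₀ hk0]
    nlinarith
  have h3 : coneLL Cp w (Ψ (t / k) w) := by
    apply hball
    rw [Real.dist_eq, abs_lt]
    constructor <;> linarith
  have h4 := hit (t / k) (by positivity) h3.le k
  rwa [mul_div_cancel₀ _ hk0.ne'] at h4

/-- Nonordering of limit sets: two limit points of the same orbit are never related. -/
lemma eq_of_mapClusterPt_of_coneLe (hΨ : IsFlow Ψ) (hC : IsConeOrder Cp)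
    (hm : StronglyMonotone Ψ Cp) {z p q : Euc n}
    (hp : MapClusterPt p atTop fun t => Ψ t z) (hq : MapClusterPt q atTop fun t => Ψ t z)
    (hpq : coneLe Cp p q) : p = q := by
  by_contra hne
  have hLL : coneLL Cp (Ψ 1 p) (Ψ 1 q) := hm 1 one_pos p q ⟨hpq, fun e => hne e.symm⟩
  obtain ⟨U, hU, V, hV, hUV⟩ := mem_nhds_prod_iff.mp (isOpen_coneLL.mem_nhds hLL)
  obtain ⟨t₁, ht₁⟩ := ((hΨ.mapClusterPt_apply hp 1).frequently hU).exists
  obtain ⟨t₂, ht₂, ht₁₂⟩ :=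
    (((hΨ.mapClusterPt_apply hq 1).frequently hV).and_eventually (eventually_gt_atTop t₁)).exists
  have hup : coneLL Cp (Ψ t₁ z) (Ψ (t₂ - t₁) (Ψ t₁ z)) := by
    rw [hΨ.2.2, sub_add_cancel]
    exact hUV (Set.mk_mem_prod ht₁ ht₂)
  obtain ⟨T₀, hT₀⟩ := exists_forall_ge_coneLe hΨ hC hm (sub_pos.mpr ht₁₂) hup
  have hmono : ∀ t ≥ t₁, ∀ τ ≥ t + T₀, coneLe Cp (Ψ t z) (Ψ τ z) := by
    intro t ht τ hτ
    have h := hm.map_le hΨ hC (sub_nonneg.mpr ht) (hT₀ (τ - t) (by linarith))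
    simp only [hΨ.2.2] at h
    have e : t - t₁ + (τ - t + t₁) = τ := by ring
    rwa [sub_add_cancel, e] at h
  have hle : coneLe Cp q p := by
    have hclosed : IsClosed {y : Euc n | coneLe Cp y p} :=
      (isClosed_coneLe hC).preimage (continuous_id.prodMk continuous_const)
    refine hclosed.mem_of_mapClusterPt hq ?_
    filter_upwards [eventually_ge_atTop t₁] with t ht
    have hclosed' : IsClosed {y : Euc n | coneLe Cp (Ψ t z) y} :=
      (isClosed_coneLe hC).preimage (continuous_const.prodMk continuous_id)
    refine hclosed'.mem_of_mapClusterPt hp ?_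
    filter_upwards [eventually_ge_atTop (t + T₀)] with τ hτ
    exact hmono t ht τ hτ
  exact hne (coneLe_antisymm hC hpq hle)


lemma mem_equilibria_of_eventually_coneLe (hΨ : IsFlow Ψ) (hC : IsConeOrder Cp)
    (hm : StronglyMonotone Ψ Cp) {p : Euc n} (h : ∀ᶠ t in 𝓝 (0 : ℝ), coneLe Cp (Ψ t p) p) :
    p ∈ equilibria Ψ := by
  have hfix : ∀ t : ℝ, 0 ≤ t → coneLe Cp (Ψ t p) p → coneLe Cp (Ψ (-t) p) p → Ψ t p = p := by
    intro t ht h1 h2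
    have h3 := hm.map_le hΨ hC ht h2
    rw [hΨ.2.2, add_neg_cancel, hΨ.2.1] at h3
    exact coneLe_antisymm hC h1 h3
  have hneg : Tendsto (fun t : ℝ => -t) (𝓝 0) (𝓝 0) := by
    simpa using (continuous_neg (G := ℝ)).tendsto 0
  refine hΨ.mem_equilibria_of_eventually ?_
  filter_upwards [h, hneg.eventually h] with t h1 h2
  rcases le_total 0 t with ht | ht
  · exact hfix t ht h1 h2
  · have h3 := hfix (-t) (neg_nonneg.mpr ht) h2 (by rwa [neg_neg])
    calc Ψ t p = Ψ t (Ψ (-t) p) := by rw [h3]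
      _ = p := by rw [hΨ.2.2, add_neg_cancel, hΨ.2.1]

/-- Along a strongly increasing segment with compact forward orbits, starting at a point `x`
which is approximately recurrent, some point of the segment has an equilibrium above `x` among
its limit points. -/
lemma exists_equilibrium_mapClusterPt (hΨ : IsFlow Ψ) (hC : IsConeOrder Cp)
    (hm : StronglyMonotone Ψ Cp) (h0 : (0 : Euc n) ∉ interior Cp) {Γ : Set (Euc n)}
    (hΓ : IsCompact Γ) (hinv : ∀ t : ℝ, ∀ z ∈ Γ, Ψ t z ∈ Γ) {x v : Euc n}
    (hv : v ∈ interior Cp) {δ : ℝ} (hδ : 0 < δ) (hz : ∀ s ∈ Ioo 0 δ, x + s • v ∈ Γ)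
    {y : ℕ → Euc n} {t : ℕ → ℝ} (ht : Tendsto t atTop atTop) (hy : Tendsto y atTop (𝓝 x))
    (hty : Tendsto (fun j => Ψ (t j) (y j)) atTop (𝓝 x)) :
    ∃ s ∈ Ioo 0 δ, ∃ q ∈ equilibria Ψ,
      MapClusterPt q atTop (fun τ => Ψ τ (x + s • v)) ∧ coneLe Cp x q := by
  set z : ℝ → Euc n := fun s => x + s • v with hzdef
  have hzlt : ∀ {a b : ℝ}, a < b → coneLL Cp (z a) (z b) := fun hab =>
    coneLL_add_smul hC hv x hab
  set 𝒰 : Ultrafilter ℕ := Ultrafilter.of atTop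
  have h𝒰 : (𝒰 : Filter ℕ) ≤ atTop := Ultrafilter.of_le _
  have hlim : ∀ s ∈ Ioo 0 δ, ∃ r ∈ Γ, Tendsto (fun j => Ψ (t j) (z s)) 𝒰 (𝓝 r) := by
    intro s hs
    obtain ⟨r, hrΓ, hr⟩ := hΓ.ultrafilter_le_nhds' (𝒰.map fun j => Ψ (t j) (z s))
      (Ultrafilter.mem_map.mpr (Eventually.of_forall fun j => hinv (t j) _ (hz s hs)))
    exact ⟨r, hrΓ, hr⟩
  choose! r hrΓ hr using hlim
  have hrcl : ∀ s ∈ Ioo 0 δ, MapClusterPt (r s) atTop fun τ => Ψ τ (z s) := by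
    intro s hs
    have h : MapClusterPt (r s) 𝒰 ((fun τ => Ψ τ (z s)) ∘ t) := (hr s hs).mapClusterPt
    exact h.of_comp (ht.mono_left h𝒰)
  have hxr : ∀ s ∈ Ioo 0 δ, coneLe Cp x (r s) := by
    intro s hs
    have hxz : coneLL Cp x (z s) := by simpa [hzdef] using hzlt hs.1
    refine coneLe_of_frequently hC (hty.mono_left h𝒰) (hr s hs) (Eventually.frequently ?_)
    filter_upwards [(eventually_coneLL hy tendsto_const_nhds hxz).filter_mono h𝒰,
      (ht.eventually_ge_atTop 0).filter_mono h𝒰] with j hj htj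
    exact hm.map_le hΨ hC htj hj.le
  have key : ∀ s ∈ Ioo 0 δ, ∀ u ∈ Ioo 0 δ, ∀ a b : ℝ, coneLe Cp (Ψ a (z s)) (Ψ b (z u)) →
      coneLe Cp (Ψ (a - b) (r s)) (r u) := by
    intro s hs u hu a b hab
    refine coneLe_of_frequently hC (((hΨ.continuous_point (a - b)).tendsto _).comp (hr s hs))
      (hr u hu) (Eventually.frequently ?_)
    filter_upwards [(ht.eventually_ge_atTop b).filter_mono h𝒰] with j htj
    have h := hm.map_le hΨ hC (sub_nonneg.mpr htj) hab
    rw [hΨ.2.2, hΨ.2.2, sub_add_cancel] at h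
    have e : Ψ (a - b) (Ψ (t j) (z s)) = Ψ (t j - b + a) (z s) := by
      rw [hΨ.2.2]; congr 1; ring
    simpa only [Function.comp_apply, e] using h
  have hmono : ∀ s ∈ Ioo 0 δ, ∀ u ∈ Ioo 0 δ, s < u → coneLe Cp (r s) (r u) := by
    intro s hs u hu hsu
    have h := key s hs u hu 0 0 (by simpa only [hΨ.2.1] using (hzlt hsu).le)
    rwa [sub_zero, hΨ.2.1] at h
  by_contra hcon
  have hneq : ∀ s ∈ Ioo 0 δ, r s ∉ equilibria Ψ := fun s hs hE =>
    hcon ⟨s, hs, r s, hE, hrcl s hs, hxr s hs⟩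
  have hinj : ∀ s ∈ Ioo 0 δ, ∀ u ∈ Ioo 0 δ, s < u → r s ≠ r u := by
    intro s hs u hu hsu he
    refine hneq s hs (mem_equilibria_of_eventually_coneLe hΨ hC hm ?_)
    have hlt : coneLL Cp (Ψ 0 (z s)) (z u) := by rw [hΨ.2.1]; exact hzlt hsu
    filter_upwards [eventually_coneLL ((hΨ.continuous_time (z s)).tendsto 0)
      tendsto_const_nhds hlt] with h hh
    have h1 := key s hs u hu h 0 (by rw [hΨ.2.1]; exact hh.le)
    rwa [sub_zero, ← he] at h1
  have horbit : ∀ s ∈ Ioo 0 δ, ∀ u ∈ Ioo 0 δ, s < u → ∀ h : ℝ, coneLe Cp (Ψ h (r s)) (r u) := by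
    intro s hs u hu hsu
    set H : Set ℝ := {h | coneLe Cp (Ψ h (r s)) (r u)}
    have hclosed : IsClosed H :=
      (isClosed_coneLe hC).preimage ((hΨ.continuous_time (r s)).prodMk continuous_const)
    have hopen : IsOpen H := by
      rw [isOpen_iff_mem_nhds]
      intro h hh
      have hne : r u ≠ Ψ h (r s) := by
        intro he
        have hle := hmono s hs u hu hsu
        rw [he] at hle
        have := eq_of_mapClusterPt_of_coneLe hΨ hC hm (hrcl s hs)
          (hΨ.mapClusterPt_apply (hrcl s hs) h) hle
        exact hinj s hs u hu hsu (this.trans he.symm)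
      have hLL := hm 1 one_pos _ _ ⟨hh, hne⟩
      rw [hΨ.2.2] at hLL
      have hf : Tendsto (fun p : ℝ × ℕ => Ψ (1 + p.1) (Ψ (t p.2) (z s))) (𝓝 h ×ˢ (𝒰 : Filter ℕ))
          (𝓝 (Ψ (1 + h) (r s))) := by
        have h1 : Tendsto (fun p : ℝ × ℕ => (1 + p.1, Ψ (t p.2) (z s)))
            (𝓝 h ×ˢ (𝒰 : Filter ℕ)) (𝓝 (1 + h, r s)) :=
          (tendsto_const_nhds.add tendsto_fst).prodMk_nhds ((hr s hs).comp tendsto_snd)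
        exact (hΨ.1.tendsto (1 + h, r s)).comp h1
      have hg : Tendsto (fun p : ℝ × ℕ => Ψ 1 (Ψ (t p.2) (z u))) (𝓝 h ×ˢ (𝒰 : Filter ℕ))
          (𝓝 (Ψ 1 (r u))) :=
        ((hΨ.continuous_point 1).tendsto _).comp ((hr u hu).comp tendsto_snd)
      filter_upwards [(eventually_coneLL hf hg hLL).curry] with h' hh'
      obtain ⟨j, hj⟩ := hh'.exists
      simp only [hΨ.2.2] at hj
      have h2 := key s hs u hu _ _ hj.le
      have e : 1 + h' + t j - (1 + t j) = h' := by ring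
      rwa [e] at h2
    have huniv : H = univ := IsClopen.eq_univ ⟨hclosed, hopen⟩
      ⟨0, by
        change coneLe Cp (Ψ 0 (r s)) (r u)
        rw [hΨ.2.1]
        exact hmono s hs u hu hsu⟩
    intro h
    have : h ∈ H := huniv ▸ mem_univ h
    exact this
  have hnear : ∀ s ∈ Ioo 0 δ, ∀ᶠ u in 𝓝[>] s, u ∈ Ioo 0 δ := fun s hs =>
    mem_nhdsWithin_of_mem_nhds (isOpen_Ioo.mem_nhds hs)
  have hR : ∀ s ∈ Ioo 0 δ, ∃ R, MapClusterPt R (𝓝[>] s) r := by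
    intro s hs
    obtain ⟨R, -, h⟩ := hΓ.exists_mapClusterPt (f := 𝓝[>] s) (u := r)
      (tendsto_principal.mpr ((hnear s hs).mono hrΓ))
    exact ⟨R, h⟩
  choose! R hR using hR
  have hRr : ∀ s ∈ Ioo 0 δ, ∀ u ∈ Ioo 0 δ, s < u → coneLe Cp (R s) (r u) := by
    intro s hs u hu hsu
    have hclosed : IsClosed {w : Euc n | coneLe Cp w (r u)} :=
      (isClosed_coneLe hC).preimage (continuous_id.prodMk continuous_const)
    refine hclosed.mem_of_mapClusterPt (hR s hs) ?_
    filter_upwards [hnear s hs, mem_nhdsWithin_of_mem_nhds (Iio_mem_nhds hsu)] with w hw hwu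
    exact hmono w hw u hu hwu
  have hrR : ∀ s ∈ Ioo 0 δ, ∀ h : ℝ, coneLe Cp (Ψ h (r s)) (R s) := by
    intro s hs h
    have hclosed : IsClosed {w : Euc n | coneLe Cp (Ψ h (r s)) w} :=
      (isClosed_coneLe hC).preimage (continuous_const.prodMk continuous_id)
    refine hclosed.mem_of_mapClusterPt (hR s hs) ?_
    filter_upwards [hnear s hs, self_mem_nhdsWithin] with w hw hsw
    exact horbit s hs w hw hsw h
  have hjump : ∀ s ∈ Ioo 0 δ, coneLL Cp (Ψ 1 (r s)) (Ψ 1 (R s)) := by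
    intro s hs
    refine hm 1 one_pos _ _ ⟨hΨ.2.1 (r s) ▸ hrR s hs 0, fun he => ?_⟩
    refine hneq s hs (mem_equilibria_of_eventually_coneLe hΨ hC hm (Eventually.of_forall ?_))
    intro h
    simpa only [he] using hrR s hs h
  set O : ℝ → Set (Euc n) := fun s =>
    {w | coneLL Cp (Ψ 1 (r s)) w ∧ coneLL Cp w (Ψ 1 (R s))}
  have hlt : ∀ s ∈ Ioo 0 δ, ∀ u ∈ Ioo 0 δ, s < u → Disjoint (O s) (O u) := by
    intro s hs u hu hsu
    rw [Set.disjoint_left]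
    rintro w ⟨-, hw1⟩ ⟨hw2, -⟩
    have h1 : coneLe Cp (Ψ 1 (R s)) (Ψ 1 (r u)) :=
      hm.map_le hΨ hC zero_le_one (hRr s hs u hu hsu)
    have h2 : coneLL Cp w w := coneLL_trans_coneLe hC (coneLL_trans_coneLe hC hw1 h1) hw2.le
    exact h0 (by simpa [coneLL] using h2)
  have hcount : (Ioo 0 δ).Countable := by
    refine Set.PairwiseDisjoint.countable_of_isOpen (s := O) ?_ ?_ ?_
    · intro s hs u hu hsu
      rcases lt_or_gt_of_ne hsu with h | h
      · exact hlt s hs u hu h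
      · exact (hlt u hu s hs h).symm
    · intro s _
      exact (isOpen_coneLL.preimage (continuous_const.prodMk continuous_id)).inter
        (isOpen_coneLL.preimage (continuous_id.prodMk continuous_const))
    · intro s hs
      have h1 := coneLL_add_smul hC (hjump s hs) (Ψ 1 (r s)) (a := 0) (b := 1 / 2) (by norm_num)
      have h2 := coneLL_add_smul hC (hjump s hs) (Ψ 1 (r s)) (a := 1 / 2) (b := 1) (by norm_num)
      simp only [zero_smul, add_zero, one_smul, add_sub_cancel] at h1 h2
      exact ⟨_, h1, h2⟩
  exact absurd (Cardinal.Real.Ioo_countable_iff.mp hcount) (not_le.mpr hδ)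

end MonotoneFlow

section CompetitiveFlow

variable {n : ℕ} {Φ : ℝ → Euc n → Euc n} {Cp Γ : Set (Euc n)}

lemma IsFlow.reverse (hΦ : IsFlow Φ) : IsFlow fun t => Φ (-t) := by
  refine ⟨hΦ.1.comp (continuous_fst.neg.prodMk continuous_snd), fun x => ?_, fun t s x => ?_⟩
  · simpa using hΦ.2.1 x
  · change Φ (-t) (Φ (-s) x) = Φ (-(t + s)) x
    rw [hΦ.2.2, neg_add]

lemma StronglyCompetitive.reverse (hΦ : IsFlow Φ) (hcomp : StronglyCompetitive Φ Cp) :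
    StronglyMonotone (fun t => Φ (-t)) Cp := by
  intro t ht x y hxy
  refine (hcomp t ht _ _).2 ?_
  rwa [hΦ.2.2, hΦ.2.2, add_neg_cancel, hΦ.2.1, hΦ.2.1]

lemma Invariant.apply_mem (h : Invariant Φ Γ) (t : ℝ) {z : Euc n} (hz : z ∈ Γ) : Φ t z ∈ Γ := by
  rw [← h t]
  exact mem_image_of_mem _ hz

lemma mem_alphaSet_of_mapClusterPt {z q : Euc n}
    (h : MapClusterPt q atTop fun t => Φ (-t) z) : q ∈ alphaSet Φ z := by
  refine mem_iInter₂.mpr fun t _ => ?_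
  refine isClosed_closure.mem_of_mapClusterPt h ?_
  filter_upwards [eventually_ge_atTop (-t)] with τ hτ
  exact subset_closure ⟨-τ, by simpa using neg_le.mp hτ, rfl⟩

lemma exists_return_time {y : Euc n} (hy : y ∈ recurrentSet Φ) {T ε : ℝ} (hT : 0 ≤ T)
    (hε : 0 < ε) : ∃ t ≥ T, dist (Φ t y) y < ε := by
  have h := mem_iInter₂.mp hy T hT
  obtain ⟨_, ⟨t, ht, rfl⟩, hd⟩ := Metric.mem_closure_iff.mp h ε hε
  exact ⟨t, ht, by rwa [dist_comm]⟩

lemma Dissipative.birkhoffCenter_subset (hΓ : Dissipative Φ Γ) : birkhoffCenter Φ ⊆ Γ := by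
  obtain ⟨hne, hcpt, -, hattr⟩ := hΓ
  refine closure_minimal (fun y hy => ?_) hcpt.isClosed
  rw [hcpt.isClosed.mem_iff_infDist_zero hne]
  refine le_antisymm (le_of_forall_pos_lt_add fun ε hε => ?_) infDist_nonneg
  obtain ⟨T, hT⟩ := hattr {y} isCompact_singleton (ε / 2) (half_pos hε)
  obtain ⟨t, ht, hd⟩ := exists_return_time hy (le_max_right T 0) (half_pos hε)
  have h1 := hT t ((le_max_left T 0).trans ht) y rfl
  have h2 : infDist y Γ ≤ infDist (Φ t y) Γ + dist y (Φ t y) :=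
    infDist_le_infDist_add_dist
  rw [dist_comm] at h2
  linarith

lemma Dissipative.mem_repInfty (hΦ : IsFlow Φ) (hΓ : Dissipative Φ Γ) {z : Euc n}
    (hz : z ∉ Γ) : z ∈ repInfty Φ := by
  obtain ⟨hne, hcpt, -, hattr⟩ := hΓ
  have hpos : 0 < infDist z Γ :=
    (infDist_pos_iff_notMem_closure hne).mp (by rwa [hcpt.isClosed.closure_eq])
  refine tendsto_atTop.mpr fun M => ?_
  obtain ⟨T, hT⟩ := hattr (closedBall 0 M) (isCompact_closedBall 0 M) _ hpos
  filter_upwards [eventually_ge_atTop T] with t ht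
  by_contra! hlt
  have h := hT t ht (Φ (-t) z) (by simpa using hlt.le)
  rw [hΦ.2.2, add_neg_cancel, hΦ.2.1] at h
  exact lt_irrefl _ h

/-- Points outside the attractor lying strongly above a point of the attractor are repelled
from `+∞`. -/
lemma Dissipative.mem_RminusInfty (hΦ : IsFlow Φ) (hC : IsConeOrder Cp)
    (hcomp : StronglyCompetitive Φ Cp) (h0 : (0 : Euc n) ∉ interior Cp) (hΓ : Dissipative Φ Γ)
    {xlo : Euc n} (hlo : ∀ g ∈ Γ, coneLe Cp xlo g) {x z : Euc n} (hx : x ∈ Γ)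
    (hz : z ∉ Γ) (hxz : coneLL Cp x z) : z ∈ RminusInfty Φ Cp xlo := by
  have hopen : IsOpen (Γᶜ ∩ {w : Euc n | coneLL Cp x w}) :=
    hΓ.2.1.isClosed.isOpen_compl.inter
      (isOpen_coneLL.preimage (continuous_const.prodMk continuous_id))
  refine interior_maximal ?_ hopen ⟨hz, hxz⟩
  rintro w ⟨hw, hxw⟩
  refine ⟨hΓ.mem_repInfty hΦ hw, 1, one_pos, fun t ht => ?_⟩
  refine coneLe_trans_coneLL hC (hlo _ (hΓ.2.2.1.apply_mem (-t) hx)) ?_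
  refine hcomp.reverse hΦ t (by linarith) x w ⟨hxw.le, ?_⟩
  rintro rfl
  exact h0 (by simpa [coneLL] using hxw)

/-- If all points near `x` and strongly above it lie in the attractor, then arbitrarily close
to `x` there are such points whose `α`-limit set contains an equilibrium above `x`. -/
lemma Dissipative.exists_equilibrium_mem_alphaSet (hΦ : IsFlow Φ) (hC : IsConeOrder Cp)
    (hcomp : StronglyCompetitive Φ Cp) (h0 : (0 : Euc n) ∉ interior Cp) (hΓ : Dissipative Φ Γ)
    {x : Euc n} (hx : x ∈ birkhoffCenter Φ) {ε : ℝ} (hε : 0 < ε)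
    (hnear : ∀ z, dist z x < ε → coneLL Cp x z → z ∈ Γ) :
    ∃ z q, dist z x < ε ∧ coneLL Cp x z ∧ q ∈ alphaSet Φ z ∩ equilibria Φ ∧ coneLe Cp x q := by
  obtain ⟨v, hv⟩ := hC.2.2.2.1
  have hxv : ∀ s : ℝ, 0 < s → coneLL Cp x (x + s • v) := fun s hs => by
    simpa using coneLL_add_smul hC hv x hs
  have hlim : Tendsto (fun s : ℝ => x + s • v) (𝓝 0) (𝓝 x) := by
    have h : Continuous fun s : ℝ => x + s • v := by fun_prop
    simpa using h.tendsto 0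
  obtain ⟨δ, hδ, hball⟩ := Metric.eventually_nhds_iff.mp (hlim.eventually (ball_mem_nhds x hε))
  have hdist : ∀ s ∈ Ioo 0 δ, dist (x + s • v) x < ε := fun s hs =>
    hball (by rw [Real.dist_0_eq_abs, abs_of_pos hs.1]; exact hs.2)
  have hret : ∀ j : ℕ, ∃ y : Euc n, ∃ t : ℝ,
      j ≤ t ∧ dist y x < 1 / ((j : ℝ) + 1) ∧ dist (Φ t y) y < 1 / ((j : ℝ) + 1) := by
    intro j
    have hj : 0 < 1 / ((j : ℝ) + 1) := Nat.one_div_pos_of_nat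
    obtain ⟨y, hy, hyx⟩ := Metric.mem_closure_iff.mp hx _ hj
    obtain ⟨t, ht, hty⟩ := exists_return_time hy (Nat.cast_nonneg j) hj
    exact ⟨y, t, ht, by rwa [dist_comm], hty⟩
  choose y t ht hyx hty using hret
  have hzero := tendsto_one_div_add_atTop_nhds_zero_nat (𝕜 := ℝ)
  have hy : Tendsto y atTop (𝓝 x) := by
    rw [tendsto_iff_dist_tendsto_zero]
    exact squeeze_zero (fun _ => dist_nonneg) (fun j => (hyx j).le) hzero
  have hΦy : Tendsto (fun j => Φ (t j) (y j)) atTop (𝓝 x) := by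
    rw [tendsto_iff_dist_tendsto_zero]
    refine squeeze_zero (fun _ => dist_nonneg) (fun j => ?_)
      (by simpa only [add_zero] using hzero.add hzero)
    exact (dist_triangle _ (y j) _).trans (add_le_add (hty j).le (hyx j).le)
  obtain ⟨s, hs, q, hq, hqz, hxq⟩ := exists_equilibrium_mapClusterPt hΦ.reverse hC
    (hcomp.reverse hΦ) h0 hΓ.2.1 (fun τ z hz => hΓ.2.2.1.apply_mem (-τ) hz) hv hδ
    (fun s hs => hnear _ (hdist s hs) (hxv s hs.1))
    (tendsto_atTop_mono ht tendsto_natCast_atTop_atTop) hΦy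
    (by simpa only [hΦ.2.2, neg_add_cancel, hΦ.2.1] using hy)
  refine ⟨_, q, hdist s hs, hxv s hs.1, ⟨mem_alphaSet_of_mapClusterPt hqz, fun τ => ?_⟩, hxq⟩
  simpa using hq (-τ)

end CompetitiveFlow

theorem stmt16 {n : ℕ} (Φ : ℝ → Euc n → Euc n) (Cp Γ : Set (Euc n))
    (hΦ : IsFlow Φ) (hC : IsConeOrder Cp) (hcomp : StronglyCompetitive Φ Cp)
    (hΓ : Dissipative Φ Γ)
    (xlo : Euc n) (hlo : ∀ g ∈ Γ, coneLe Cp xlo g)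
    (B : Set (Euc n)) (x₀ : Euc n) (hx₀ : x₀ ∈ birkhoffCenter Φ)
    (hB : B = connectedComponentIn (birkhoffCenter Φ) x₀)
    (hBu : Unordered Cp B) (x : Euc n) (hx : x ∈ B) :
    (∃ z : ℕ → Euc n, ∃ q : ℕ → Euc n,
      Filter.Tendsto z Filter.atTop (nhds x) ∧ (∀ i, coneLL Cp x (z i)) ∧
      ∀ i, q i ∈ alphaSet Φ (z i) ∩ equilibria Φ ∧ coneLe Cp x (q i)) ∨
    (∃ z : ℕ → Euc n, (∀ i, z i ∈ RminusInfty Φ Cp xlo) ∧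
      Filter.Tendsto z Filter.atTop (nhds x) ∧ ∀ i, coneLL Cp x (z i)) := by
  have hxB : x ∈ birkhoffCenter Φ := by
    rw [hB] at hx
    exact connectedComponentIn_subset _ _ hx
  by_cases h0 : (0 : Euc n) ∈ interior Cp
  · have := subsingleton_of_zero_mem_interior_cone hC h0
    refine Or.inl ⟨fun _ => x, fun _ => x, tendsto_const_nhds, fun _ => ?_, fun _ =>
      ⟨⟨mem_iInter₂.mpr fun t _ => ?_, fun _ => Subsingleton.elim _ _⟩, coneLe_refl hC x⟩⟩
    · simpa [coneLL] using h0
    · exact subset_closure ⟨t, self_mem_Iic, Subsingleton.elim _ _⟩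
  have hpos : ∀ i : ℕ, 0 < 1 / ((i : ℝ) + 1) := fun i => Nat.one_div_pos_of_nat
  have hconv : ∀ z : ℕ → Euc n, (∀ i : ℕ, dist (z i) x < 1 / ((i : ℝ) + 1)) →
      Tendsto z atTop (𝓝 x) := by
    intro z hz
    rw [tendsto_iff_dist_tendsto_zero]
    exact squeeze_zero (fun _ => dist_nonneg) (fun i => (hz i).le)
      (tendsto_one_div_add_atTop_nhds_zero_nat (𝕜 := ℝ))
  by_cases hnear : ∃ ε > 0, ∀ z, dist z x < ε → coneLL Cp x z → z ∈ Γ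
  · left
    obtain ⟨ε, hε, hnear⟩ := hnear
    have hex : ∀ i : ℕ, ∃ z q, dist z x < min ε (1 / ((i : ℝ) + 1)) ∧ coneLL Cp x z ∧
        q ∈ alphaSet Φ z ∩ equilibria Φ ∧ coneLe Cp x q := fun i =>
      hΓ.exists_equilibrium_mem_alphaSet hΦ hC hcomp h0 hxB (lt_min hε (hpos i))
        fun z hz => hnear z (hz.trans_le (min_le_left _ _))
    choose z q hz hxz hq hxq using hex
    exact ⟨z, q, hconv z fun i => (hz i).trans_le (min_le_right _ _), hxz,
      fun i => ⟨hq i, hxq i⟩⟩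
  · right
    push Not at hnear
    choose z hz hxz hzΓ using fun i : ℕ => hnear _ (hpos i)
    exact ⟨z, fun i => hΓ.mem_RminusInfty hΦ hC hcomp h0 hlo (hΓ.birkhoffCenter_subset hxB)
      (hzΓ i) (hxz i), hconv z hz, hxz⟩
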